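/- Let H be a quasi-triangular Hopf algebra with R-matrix R. The left shifted Drinfeld map j_l : H* → H, f ↦ Σ f(S⁻¹(R'₂ R₁)) R'₁ R₂ (where R₂₁R = Σ R'₂R₁ ⊗ R'₁R₂), is an H-module map from the dual adjoint representation H*_ad to the adjoint representation H_ad: j_l(ad* h (f)) = ad h (j_l(f)) for all h ∈ H, f ∈ H*, where ad* h (f)(x) = f(ad S⁻¹(h)(x)). -/

import Mathlib

open TensorProduct

variable {k H : Type*} [Field k] [Ring H] [HopfAlgebra k H]

/-- The bilinear map `(h₁, h₂) ↦ (x ↦ h₁ x S(h₂))` underlying the adjoint action. -/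
noncomputable def adBil (k H : Type*) [Field k] [Ring H] [HopfAlgebra k H] :
    H →ₗ[k] H →ₗ[k] (H →ₗ[k] H) :=
  (LinearMap.lcomp k (H →ₗ[k] H)
      ((LinearMap.mul k H).flip ∘ₗ HopfAlgebra.antipode (R := k))) ∘ₗ
    (LinearMap.llcomp k H H H ∘ₗ LinearMap.mul k H)

/-- The left Hopf-adjoint action of `h`, as a linear endomorphism: `x ↦ Σ h₁ x S(h₂)`. -/
noncomputable def adR (h : H) : H →ₗ[k] H :=
  TensorProduct.lift (adBil k H) (Coalgebra.comul (R := k) h)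

/-- The dual adjoint action `(ad* h f)(x) = f (ad S⁻¹(h) x)` on `H*`. -/
noncomputable def adStar (Sinv : H →ₗ[k] H) (h : H) (f : H →ₗ[k] k) : H →ₗ[k] k :=
  f ∘ₗ adR (k := k) (Sinv h)

/-- The left shifted Drinfeld map `j_l(f) = Σ f(S⁻¹(M₁)) M₂` where `M = R₂₁ R`. -/
noncomputable def jl (Sinv : H →ₗ[k] H) (M : H ⊗[k] H) (f : H →ₗ[k] k) : H :=
  TensorProduct.lift ((LinearMap.lsmul k H) ∘ₗ (f ∘ₗ Sinv)) M


section Helpers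

open Coalgebra HopfAlgebra WithConv

/-- The embedding into the left tensor factor, in the convolution algebra. -/
noncomputable def cvL (k : Type*) {H : Type*} [Field k] [Ring H] [HopfAlgebra k H]
    (g : H →ₗ[k] H) : WithConv (H →ₗ[k] H ⊗[k] H) :=
  toConv ((Algebra.TensorProduct.includeLeft (R := k) (S := k) (A := H) (B := H)).toLinearMap ∘ₗ g)

/-- The embedding into the right tensor factor, in the convolution algebra. -/
noncomputable def cvR (k : Type*) {H : Type*} [Field k] [Ring H] [HopfAlgebra k H]
    (g : H →ₗ[k] H) : WithConv (H →ₗ[k] H ⊗[k] H) :=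
  toConv ((Algebra.TensorProduct.includeRight (R := k) (A := H) (B := H)).toLinearMap ∘ₗ g)

/-- The map `h ↦ ε(h) M`, in the convolution algebra. -/
noncomputable def cvM (M : H ⊗[k] H) : WithConv (H →ₗ[k] H ⊗[k] H) :=
  toConv ((counit (R := k) (A := H)).smulRight M)

lemma cvL_apply (g : H →ₗ[k] H) (x : H) : cvL k g x = g x ⊗ₜ[k] 1 := rfl
lemma cvR_apply (g : H →ₗ[k] H) (x : H) : cvR k g x = 1 ⊗ₜ[k] g x := rfl
lemma cvM_apply (M : H ⊗[k] H) (x : H) : cvM M x = counit (R := k) x • M := rfl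

lemma cvL_inv : cvL k (antipode k (A := H)) * cvL k LinearMap.id = 1 := by
  ext x
  rw [(ℛ k x).convMul_apply]
  simp only [cvL_apply, Algebra.TensorProduct.tmul_mul_tmul, LinearMap.id_apply, mul_one,
    ← TensorProduct.sum_tmul, sum_antipode_mul_eq_algebraMap_counit]
  simp [Algebra.TensorProduct.algebraMap_apply]

lemma cvR_inv : cvR k LinearMap.id * cvR k (antipode k (A := H)) = 1 := by
  ext x
  rw [(ℛ k x).convMul_apply]
  simp only [cvR_apply, Algebra.TensorProduct.tmul_mul_tmul, LinearMap.id_apply, mul_one,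
    ← TensorProduct.tmul_sum, sum_mul_antipode_eq_algebraMap_counit]
  simp [Algebra.algebraMap_eq_smul_one, Algebra.TensorProduct.one_def,
    TensorProduct.smul_tmul']

lemma cvR_inv' : cvR k (antipode k (A := H)) * cvR k LinearMap.id = 1 := by
  ext x
  rw [(ℛ k x).convMul_apply]
  simp only [cvR_apply, Algebra.TensorProduct.tmul_mul_tmul, LinearMap.id_apply, mul_one,
    ← TensorProduct.tmul_sum, sum_antipode_mul_eq_algebraMap_counit]
  simp [Algebra.algebraMap_eq_smul_one, Algebra.TensorProduct.one_def,
    TensorProduct.smul_tmul']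

lemma cv_comul : cvL k LinearMap.id * cvR k LinearMap.id = toConv (comul (R := k) (A := H)) := by
  ext x
  rw [(ℛ k x).convMul_apply]
  simp [cvL_apply, cvR_apply, (ℛ k x).eq]

lemma mul_cvM_apply (A : WithConv (H →ₗ[k] H ⊗[k] H)) (M : H ⊗[k] H) (x : H) :
    (A * cvM M) x = A x * M := by
  rw [(ℛ k x).convMul_apply]
  simp only [cvM_apply, mul_smul_comm]
  have h1 := congr(TensorProduct.lift ((LinearMap.lsmul k H).flip) $(sum_tmul_counit_eq (R := k) (ℛ k x)))
  simp only [map_sum, TensorProduct.lift.tmul, LinearMap.flip_apply, LinearMap.lsmul_apply,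
    one_smul] at h1
  conv_rhs => rw [← h1]
  simp [Finset.sum_mul]

lemma cvM_mul_apply (A : WithConv (H →ₗ[k] H ⊗[k] H)) (M : H ⊗[k] H) (x : H) :
    (cvM M * A) x = M * A x := by
  rw [(ℛ k x).convMul_apply]
  simp only [cvM_apply, smul_mul_assoc]
  conv_rhs => rw [← sum_counit_smul (ℛ k x)]
  simp [Finset.mul_sum]

lemma comul_antipode_eq : toConv (comul ∘ₗ antipode k (A := H))
    = cvR k (antipode k (A := H)) * cvL k (antipode k (A := H)) := by
  symm
  apply left_inv_eq_right_inv (a := toConv (comul (R := k) (A := H)))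
  · rw [← cv_comul, mul_assoc, ← mul_assoc (cvL k _) (cvL k _), cvL_inv, one_mul, cvR_inv']
  · exact LinearMap.comul_right_inv

lemma comul_antipode_apply (x : H) : comul (R := k) (antipode k x)
    = TensorProduct.map (antipode k) (antipode k) (TensorProduct.comm k H H (comul x)) := by
  have := congr($(comul_antipode_eq (k := k) (H := H)) x)
  rw [(ℛ k x).convMul_apply] at this
  conv_rhs => rw [← (ℛ k x).eq]
  simpa [cvL_apply, cvR_apply] using this

lemma key (M : H ⊗[k] H) (hM : ∀ x : H, M * comul (R := k) x = comul (R := k) x * M) :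
    cvL k (antipode k) * cvM M * cvL k LinearMap.id
      = cvR k LinearMap.id * cvM M * cvR k (antipode k) := by
  have h1 : cvM M * (cvL k LinearMap.id * cvR k LinearMap.id)
      = (cvL k LinearMap.id * cvR k LinearMap.id) * cvM M := by
    rw [cv_comul]
    ext x
    rw [mul_cvM_apply, cvM_mul_apply]
    exact hM x
  calc _ = cvL k (antipode k) * (cvM M * (cvL k LinearMap.id * cvR k LinearMap.id))
        * cvR k (antipode k) := by
          simp only [mul_assoc]; rw [cvR_inv, mul_one]
    _ = (cvL k (antipode k) * cvL k LinearMap.id) * (cvR k LinearMap.id * cvM M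
        * cvR k (antipode k)) := by rw [h1]; simp only [mul_assoc]
    _ = _ := by rw [cvL_inv, one_mul]

lemma jl_add (Sinv : H →ₗ[k] H) (M N : H ⊗[k] H) (f : H →ₗ[k] k) :
    jl Sinv (M + N) f = jl Sinv M f + jl Sinv N f := map_add _ _ _

lemma jl_tmul (Sinv : H →ₗ[k] H) (a b : H) (f : H →ₗ[k] k) :
    jl Sinv (a ⊗ₜ b) f = f (Sinv a) • b := rfl

lemma jl_sum (Sinv : H →ₗ[k] H) {ι : Type*} (s : Finset ι) (M : ι → H ⊗[k] H) (f : H →ₗ[k] k) :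
    jl Sinv (∑ i ∈ s, M i) f = ∑ i ∈ s, jl Sinv (M i) f := map_sum _ _ _

lemma adBil_apply (a b x : H) : adBil k H a b x = a * (x * antipode k b) := rfl

end Helpers

/-- for a quasi-triangular Hopf algebra `H` with invertible antipode and
R-matrix `R`, the left shifted Drinfeld map `j_l : H* → H`,
`f ↦ Σ f(S⁻¹(R'₂R₁)) R'₁R₂`, intertwines the dual adjoint representation `H*_ad` with
the adjoint representation `H_ad`: `j_l(ad* h f) = ad h (j_l f)`. -/
theorem stmt_9
    (Sinv : H →ₗ[k] H)
    (hS1 : ∀ x : H, HopfAlgebra.antipode (R := k) (Sinv x) = x)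
    (hS2 : ∀ x : H, Sinv (HopfAlgebra.antipode (R := k) x) = x)
    (R : H ⊗[k] H)
    (hR1 : ∀ x : H,
      (TensorProduct.comm k H H (Coalgebra.comul (R := k) x)) * R
        = R * Coalgebra.comul (R := k) x)
    (hR2 : (TensorProduct.assoc k H H H)
        ((TensorProduct.map (Coalgebra.comul (R := k)) LinearMap.id) R)
      = (TensorProduct.map LinearMap.id
            (Algebra.TensorProduct.includeRight (R := k) (A := H) (B := H)).toLinearMap) R
        * (Algebra.TensorProduct.includeRight (R := k) (A := H) (B := H ⊗[k] H)) R)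
    (hR3 : (TensorProduct.map LinearMap.id (Coalgebra.comul (R := k))) R
      = (TensorProduct.map LinearMap.id
            (Algebra.TensorProduct.includeRight (R := k) (A := H) (B := H)).toLinearMap) R
        * (TensorProduct.map LinearMap.id
            (Algebra.TensorProduct.includeLeft (R := k) (S := k) (A := H) (B := H)).toLinearMap) R)
    (h : H) (f : H →ₗ[k] k) :
    jl Sinv ((TensorProduct.comm k H H R) * R) (adStar Sinv h f)
      = adR (k := k) h (jl Sinv ((TensorProduct.comm k H H R) * R) f) := by
  classical
  have hSm : ∀ a b : H, Sinv (a * b) = Sinv b * Sinv a := fun a b => by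
    rw [← hS2 (Sinv b * Sinv a), HopfAlgebra.antipode_mul_antidistrib, hS1, hS1]
  have hSc : ∀ x : H, Coalgebra.comul (R := k) (Sinv x) = TensorProduct.map Sinv Sinv
      (TensorProduct.comm k H H (Coalgebra.comul x)) := fun x => by
    have h1 := comul_antipode_apply (k := k) (Sinv x)
    rw [hS1] at h1
    have hid : Sinv ∘ₗ HopfAlgebra.antipode k = LinearMap.id := LinearMap.ext hS2
    have h2 : ∀ t : H ⊗[k] H, TensorProduct.map Sinv Sinv (TensorProduct.comm k H H
        (TensorProduct.map (HopfAlgebra.antipode k) (HopfAlgebra.antipode k)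
          (TensorProduct.comm k H H t))) = t := fun t => by
      induction t with
      | zero => simp
      | add a b ha hb => simp only [map_add, ha, hb]
      | tmul a b => simp [hS2]
    rw [h1, h2]
  have hc : ∀ a b : H ⊗[k] H, TensorProduct.comm k H H (a * b)
      = TensorProduct.comm k H H a * TensorProduct.comm k H H b := fun a b =>
    map_mul (Algebra.TensorProduct.comm k H H) a b
  have hM : ∀ x : H, (TensorProduct.comm k H H R * R) * Coalgebra.comul (R := k) x
      = Coalgebra.comul (R := k) x * (TensorProduct.comm k H H R * R) := fun x => by
    have h1 := congr(TensorProduct.comm k H H $(hR1 x))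
    rw [hc, hc, TensorProduct.comm_comm] at h1
    rw [mul_assoc, ← hR1, ← mul_assoc, ← h1, mul_assoc]
  generalize TensorProduct.comm k H H R * R = M at hM
  have hk := congr(jl Sinv ($(key M hM) h) f)
  have r := Coalgebra.Repr.arbitrary k h
  rw [r.convMul_apply, r.convMul_apply, jl_sum, jl_sum] at hk
  simp only [mul_cvM_apply, cvL_apply, cvR_apply, LinearMap.id_apply] at hk
  convert hk using 1
  · simp only [adStar, adR, hSc]
    rw [← r.eq]
    clear hM hk
    induction M with
    | zero => simp [jl]
    | add a b ha hb => simp only [jl_add, mul_add, add_mul, Finset.sum_add_distrib, ha, hb]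
    | tmul a b =>
      simp [jl_tmul, adBil_apply, hSm, hS1, hS2, Finset.sum_smul, mul_assoc]
  · simp only [adR]
    rw [← r.eq]
    clear hM hk
    induction M with
    | zero => simp [jl]
    | add a b ha hb => simp only [jl_add, map_add, mul_add, add_mul, Finset.sum_add_distrib, ha, hb]
    | tmul a b =>
      simp [jl_tmul, adBil_apply, mul_assoc, Finset.smul_sum]
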